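/- (Krieger generator theorem.) Let (X, 𝓑, μ) be a standard Borel probability space, T : X → X a bimeasurable bijection preserving μ and ergodic, and suppose the Kolmogorov–Sinai entropy h_μ(T) = sup{ h_μ(T, Z) : Z finite measurable partition } is finite. Then there exists a finite measurable partition Z of X that is generating for T, i.e. the smallest σ-algebra containing T^{−n}I for all n ∈ ℤ and all elements I of Z coincides with 𝓑 up to μ-null sets. -/

import Mathlib

open MeasureTheory Filter

/-- The entropy `H_μ(Z_n)` of the join `Z_n = Z ∨ T⁻¹Z ∨ … ∨ T^{-n+1}Z` of a finite
measurable partition `Z = {Z i}_{i : Fin N}` (convention `0 log 0 = 0`). -/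
noncomputable def joinEntropy {X : Type*} [MeasurableSpace X] (μ : Measure X)
    (T : X → X) {N : ℕ} (Z : Fin N → Set X) (n : ℕ) : ℝ :=
  ∑ s : Fin n → Fin N,
    Real.negMulLog (μ (⋂ k : Fin n, T^[(k : ℕ)] ⁻¹' Z (s k))).toReal

namespace KriegerGenerator

/-- Shannon entropy of a random variable with finitely many values. -/
noncomputable def rvEntropy {X α : Type*} [MeasurableSpace X] [Fintype α] (μ : Measure X)
    (f : X → α) : ℝ :=
  ∑ a, Real.negMulLog (μ.real (f ⁻¹' {a}))

/-- The word of length `n` read by the observable `q` along the orbit. -/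
def word {X α : Type*} (T : X → X) (q : X → α) (n : ℕ) (x : X) : Fin n → α :=
  fun k => q (T^[(k : ℕ)] x)

theorem measurable_word {X α : Type*} [MeasurableSpace X] [MeasurableSpace α] {T : X → X}
    (hT : Measurable T) {q : X → α} (hq : Measurable q) (n : ℕ) : Measurable (word T q n) :=
  measurable_pi_lambda _ fun k => hq.comp (hT.iterate k)

section Entropy

variable {X α β γ : Type*} [MeasurableSpace X] {μ : Measure X} [IsProbabilityMeasure μ]
  [Fintype α] [MeasurableSpace α] [MeasurableSingletonClass α]
  [Fintype β] [MeasurableSpace β] [MeasurableSingletonClass β]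
  [Fintype γ] [MeasurableSpace γ] [MeasurableSingletonClass γ]

theorem integral_comp_finite {f : X → α} (hf : Measurable f) (φ : α → ℝ) :
    ∫ x, φ (f x) ∂μ = ∑ a, μ.real (f ⁻¹' {a}) * φ a := by
  have : IsProbabilityMeasure (μ.map f) := Measure.isProbabilityMeasure_map hf.aemeasurable
  rw [← integral_map hf.aemeasurable
    (measurable_of_finite φ).aestronglyMeasurable, integral_fintype .of_finite]
  refine Finset.sum_congr rfl fun a _ => ?_
  rw [map_measureReal_apply hf (measurableSet_singleton a), smul_eq_mul]

theorem integrable_comp_finite {f : X → α} (hf : Measurable f) (φ : α → ℝ) :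
    Integrable (fun x => φ (f x)) μ := by
  have : IsProbabilityMeasure (μ.map f) := Measure.isProbabilityMeasure_map hf.aemeasurable
  exact (Integrable.of_finite (f := φ) (μ := μ.map f)).comp_measurable hf

theorem rvEntropy_eq_integral {f : X → α} (hf : Measurable f) :
    rvEntropy μ f = ∫ x, - Real.log (μ.real (f ⁻¹' {f x})) ∂μ := by
  rw [integral_comp_finite hf fun a => - Real.log (μ.real (f ⁻¹' {a}))]
  simp [rvEntropy, Real.negMulLog]

theorem sum_measureReal_fiber {f : X → α} (hf : Measurable f) :
    ∑ a, μ.real (f ⁻¹' {a}) = 1 := by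
  simpa using (integral_comp_finite (μ := μ) hf fun _ => (1 : ℝ)).symm

omit [IsProbabilityMeasure μ] [MeasurableSpace α] [MeasurableSingletonClass α]
  [MeasurableSpace β] [MeasurableSingletonClass β] in
theorem rvEntropy_equiv_comp (e : α ≃ β) (f : X → α) :
    rvEntropy μ (e ∘ f) = rvEntropy μ f := by
  unfold rvEntropy
  rw [← e.sum_comp]
  refine Finset.sum_congr rfl fun a _ => ?_
  congr 2
  ext x
  simp

omit [MeasurableSpace α] [MeasurableSingletonClass α] in
theorem rvEntropy_nonneg (f : X → α) : 0 ≤ rvEntropy μ f :=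
  Finset.sum_nonneg fun _ _ => Real.negMulLog_nonneg measureReal_nonneg measureReal_le_one

theorem rvEntropy_le_add {F : X → γ} (hF : Measurable F) {i : γ → α × β}
    (hi : Function.Injective i) :
    rvEntropy μ F ≤ rvEntropy μ (fun x => (i (F x)).1) + rvEntropy μ (fun x => (i (F x)).2) := by
  have ha : Measurable fun x => (i (F x)).1 := (measurable_of_finite fun c => (i c).1).comp hF
  have hb : Measurable fun x => (i (F x)).2 := (measurable_of_finite fun c => (i c).2).comp hF
  set f := fun x => (i (F x)).1 with hf
  set g := fun x => (i (F x)).2 with hg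
  have h1 : rvEntropy μ f = ∑ c, μ.real (F ⁻¹' {c}) * - Real.log (μ.real (f ⁻¹' {(i c).1})) := by
    rw [rvEntropy_eq_integral ha, ← integral_comp_finite hF]
  have h2 : rvEntropy μ g = ∑ c, μ.real (F ⁻¹' {c}) * - Real.log (μ.real (g ⁻¹' {(i c).2})) := by
    rw [rvEntropy_eq_integral hb, ← integral_comp_finite hF]
  have h3 : ∑ c, (μ.real (f ⁻¹' {(i c).1}) * μ.real (g ⁻¹' {(i c).2})) ≤ 1 := by
    calc ∑ c, (μ.real (f ⁻¹' {(i c).1}) * μ.real (g ⁻¹' {(i c).2}))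
        = ∑ d ∈ Finset.univ.map ⟨i, hi⟩, (μ.real (f ⁻¹' {d.1}) * μ.real (g ⁻¹' {d.2})) := by
          rw [Finset.sum_map]; rfl
      _ ≤ ∑ d : α × β, (μ.real (f ⁻¹' {d.1}) * μ.real (g ⁻¹' {d.2})) :=
          Finset.sum_le_sum_of_subset_of_nonneg (Finset.subset_univ _)
            fun _ _ _ => mul_nonneg measureReal_nonneg measureReal_nonneg
      _ = 1 := by
          have := Fintype.sum_mul_sum (fun a => μ.real (f ⁻¹' {a})) fun b => μ.real (g ⁻¹' {b})
          rw [sum_measureReal_fiber ha, sum_measureReal_fiber hb, one_mul] at this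
          rw [Fintype.sum_prod_type, this]
  have key : ∀ c, Real.negMulLog (μ.real (F ⁻¹' {c})) ≤
      μ.real (F ⁻¹' {c}) * - Real.log (μ.real (f ⁻¹' {(i c).1})) +
      μ.real (F ⁻¹' {c}) * - Real.log (μ.real (g ⁻¹' {(i c).2})) +
      (μ.real (f ⁻¹' {(i c).1}) * μ.real (g ⁻¹' {(i c).2}) - μ.real (F ⁻¹' {c})) := by
    intro c
    have hp1 : μ.real (F ⁻¹' {c}) ≤ μ.real (f ⁻¹' {(i c).1}) := by
      refine measureReal_mono fun x hx => ?_
      simp only [Set.mem_preimage, Set.mem_singleton_iff] at hx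
      simp [hf, hx]
    have hp2 : μ.real (F ⁻¹' {c}) ≤ μ.real (g ⁻¹' {(i c).2}) := by
      refine measureReal_mono fun x hx => ?_
      simp only [Set.mem_preimage, Set.mem_singleton_iff] at hx
      simp [hg, hx]
    generalize μ.real (f ⁻¹' {(i c).1}) = u at *
    generalize μ.real (g ⁻¹' {(i c).2}) = v at *
    have hp0 : 0 ≤ μ.real (F ⁻¹' {c}) := measureReal_nonneg
    generalize μ.real (F ⁻¹' {c}) = p at *
    rcases hp0.eq_or_lt with rfl | hp
    · simpa using mul_nonneg hp1 hp2
    · have hu := hp.trans_le hp1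
      have hv := hp.trans_le hp2
      have := Real.log_le_sub_one_of_pos (x := u * v / p) (by positivity)
      rw [Real.log_div (by positivity) hp.ne', Real.log_mul hu.ne' hv.ne'] at this
      have h4 := mul_le_mul_of_nonneg_left this hp0
      have h5 : p * (u * v / p - 1) = u * v - p := by field_simp
      rw [h5] at h4
      rw [Real.negMulLog]
      linarith
  have h4 := Finset.sum_le_sum fun c (_ : c ∈ Finset.univ) => key c
  rw [Finset.sum_add_distrib, Finset.sum_add_distrib, Finset.sum_sub_distrib, ← h1, ← h2,
    sum_measureReal_fiber hF] at h4
  unfold rvEntropy at h4 ⊢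
  linarith

omit [IsProbabilityMeasure μ] in
theorem rvEntropy_comp_measurePreserving {T : X → X} (hT : MeasurePreserving T μ μ)
    {f : X → α} (hf : Measurable f) : rvEntropy μ (f ∘ T) = rvEntropy μ f := by
  unfold rvEntropy
  refine Finset.sum_congr rfl fun a _ => ?_
  rw [Set.preimage_comp, measureReal_def, measureReal_def,
    hT.measure_preimage (hf (measurableSet_singleton a)).nullMeasurableSet]

theorem subadditive_rvEntropy_word {T : X → X} (hT : MeasurePreserving T μ μ) {q : X → α}
    (hq : Measurable q) : Subadditive fun n => rvEntropy μ (word T q n) := by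
  intro m n
  have h := rvEntropy_le_add (μ := μ) (measurable_word hT.measurable hq (m + n))
    (i := (Fin.appendEquiv m n).symm) (Equiv.injective _)
  have h1 : (fun x => ((Fin.appendEquiv m n).symm (word T q (m + n) x)).1) = word T q m := by
    ext x k
    simp [Fin.appendEquiv, word]
  have h2 : (fun x => ((Fin.appendEquiv m n).symm (word T q (m + n) x)).2) =
      word T q n ∘ T^[m] := by
    ext x k
    simp only [Fin.appendEquiv, word, Equiv.coe_fn_symm_mk, Fin.val_natAdd, Function.comp_apply]
    rw [← Function.iterate_add_apply, add_comm]
  rw [h1, h2, rvEntropy_comp_measurePreserving (hT.iterate m)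
    (measurable_word hT.measurable hq n)] at h
  exact h

/-- The entropy rate of the process generated by a finite-valued observable exists. -/
theorem exists_entropyRate {T : X → X} (hT : MeasurePreserving T μ μ) {q : X → α}
    (hq : Measurable q) :
    ∃ h : ℝ, 0 ≤ h ∧
      Tendsto (fun n : ℕ => rvEntropy μ (word T q n) / n) atTop (nhds h) := by
  have hs := subadditive_rvEntropy_word hT hq
  have ht := hs.tendsto_lim ⟨0, by
    rintro _ ⟨n, rfl⟩
    exact div_nonneg (rvEntropy_nonneg _) (Nat.cast_nonneg n)⟩
  exact ⟨hs.lim, ge_of_tendsto' ht fun n => div_nonneg (rvEntropy_nonneg _) (Nat.cast_nonneg n), ht⟩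

omit [IsProbabilityMeasure μ] [MeasurableSpace α] [MeasurableSingletonClass α] in
theorem joinEntropy_eq_rvEntropy {N : ℕ} (T : X → X) (q : X → α) (e : α ≃ Fin N) (n : ℕ) :
    joinEntropy μ T (fun i => (e ∘ q) ⁻¹' {i}) n = rvEntropy μ (word T q n) := by
  rw [← rvEntropy_equiv_comp (Equiv.arrowCongr (Equiv.refl _) e)]
  unfold joinEntropy rvEntropy
  refine Finset.sum_congr rfl fun s _ => ?_
  rw [measureReal_def]
  congr 3
  ext x
  simp [word, funext_iff]

end Entropy

theorem exists_rank {ι : Type*} [Fintype ι] (w : ι → ℝ) (hw : ∀ i, 0 ≤ w i) :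
    ∃ r : ι → ℕ, Function.Injective r ∧ ∀ i, (r i + 1) * w i ≤ ∑ j, w j := by
  classical
  let e := Fintype.equivFin ι
  let σ := Tuple.sort fun j => - w (e.symm j)
  have hσ : ∀ i j, i ≤ j → w (e.symm (σ j)) ≤ w (e.symm (σ i)) := fun i j hij => by
    have := Tuple.monotone_sort (fun j => - w (e.symm j)) hij
    simpa using this
  refine ⟨fun i => σ.symm (e i), fun i j h => ?_, fun i => ?_⟩
  · simpa [Fin.val_inj] using h
  · set j := σ.symm (e i) with hj
    have hi : w i = w (e.symm (σ j)) := by simp [hj]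
    calc ((j : ℕ) + 1 : ℝ) * w i = ∑ _l ∈ Finset.Iic j, w i := by
          simp [Finset.sum_const, Fin.card_Iic]
      _ ≤ ∑ l ∈ Finset.Iic j, w (e.symm (σ l)) :=
          Finset.sum_le_sum fun l hl => by
            rw [hi]
            exact hσ _ _ (Finset.mem_Iic.1 hl)
      _ ≤ ∑ l, w (e.symm (σ l)) :=
          Finset.sum_le_sum_of_subset_of_nonneg (Finset.subset_univ _) fun _ _ _ => hw _
      _ = ∑ l, w l := (σ.trans e.symm).sum_comp w

section Rank

variable {X α β : Type*} [MeasurableSpace X] {μ : Measure X} [IsProbabilityMeasure μ]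
  [Fintype α] [MeasurableSpace α] [MeasurableSingletonClass α]
  [Fintype β] [MeasurableSpace β] [MeasurableSingletonClass β]

omit [Fintype α] [MeasurableSpace α] [MeasurableSingletonClass α] in
/-- Values of `F` can be numbered within the fibers of `π` so that likely values have small
numbers. -/
theorem exists_conditional_rank {F : X → β} (hF : Measurable F) (π : β → α) :
    ∃ r : β → ℕ, (∀ b b', π b = π b' → r b = r b' → b = b') ∧
      ∀ b, (r b + 1) * μ.real (F ⁻¹' {b}) ≤ μ.real ((π ∘ F) ⁻¹' {π b}) := by
  classical
  choose r hr hr' using fun a : α => exists_rank (ι := {b // π b = a})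
    (fun b => μ.real (F ⁻¹' {b.1})) fun _ => measureReal_nonneg
  refine ⟨fun b => r (π b) ⟨b, rfl⟩, fun b b' h h' => ?_, fun b => ?_⟩
  · have h1 : r (π b') ⟨b, h⟩ = r (π b) ⟨b, rfl⟩ := by
      generalize π b' = a at h
      subst h
      rfl
    have := hr (π b') (h1.trans h')
    simpa using this
  · refine (hr' (π b) ⟨b, rfl⟩).trans (le_of_eq ?_)
    rw [← measureReal_iUnion_fintype]
    · congr 1
      ext x
      simp
    · intro b b' hbb'
      refine Disjoint.preimage F ?_
      simpa [Subtype.ext_iff] using hbb'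
    · exact fun b => hF (measurableSet_singleton _)

omit [IsProbabilityMeasure μ] [MeasurableSpace β] [MeasurableSingletonClass β] in
theorem ae_measureReal_fiber_pos [IsFiniteMeasure μ] (F : X → β) :
    ∀ᵐ x ∂μ, 0 < μ.real (F ⁻¹' {F x}) := by
  have h : ∀ᵐ x ∂μ, ∀ b, F x = b → 0 < μ.real (F ⁻¹' {b}) := by
    rw [ae_all_iff]
    intro b
    by_cases hb : μ (F ⁻¹' {b}) = 0
    · have := measure_eq_zero_iff_ae_notMem.1 hb
      filter_upwards [this] with x hx hx'
      exact absurd hx' hx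
    · exact Eventually.of_forall fun x _ =>
        ENNReal.toReal_pos hb (measure_ne_top μ _)
  filter_upwards [h] with x hx using hx _ rfl

/-- The conditional information of `F` given `π ∘ F`. -/
noncomputable def condInfo (μ : Measure X) (F : X → β) (π : β → α) (x : X) : ℝ :=
  Real.log (μ.real ((π ∘ F) ⁻¹' {π (F x)})) - Real.log (μ.real (F ⁻¹' {F x}))

omit [Fintype α] [MeasurableSpace α] [MeasurableSingletonClass α] in
theorem integrable_condInfo {F : X → β} (hF : Measurable F) (π : β → α) :
    Integrable (condInfo μ F π) μ :=
  integrable_comp_finite hF fun b =>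
    Real.log (μ.real ((π ∘ F) ⁻¹' {π b})) - Real.log (μ.real (F ⁻¹' {b}))

theorem integral_condInfo {F : X → β} (hF : Measurable F) (π : β → α) :
    ∫ x, condInfo μ F π x ∂μ = rvEntropy μ F - rvEntropy μ (π ∘ F) := by
  have hπ : Measurable (π ∘ F) := (measurable_of_finite π).comp hF
  rw [rvEntropy_eq_integral hF, rvEntropy_eq_integral hπ, integral_neg, integral_neg]
  unfold condInfo
  rw [integral_sub]
  · simp only [Function.comp_apply]
    ring
  · exact integrable_comp_finite hF fun b => Real.log (μ.real ((π ∘ F) ⁻¹' {π b}))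
  · exact integrable_comp_finite hF fun b => Real.log (μ.real (F ⁻¹' {b}))

omit [IsProbabilityMeasure μ] [Fintype α] [MeasurableSpace α] [MeasurableSingletonClass α]
  [MeasurableSpace β] [MeasurableSingletonClass β] in
theorem log_rank_le_condInfo [IsFiniteMeasure μ] {F : X → β} {π : β → α} {r : β → ℕ}
    (hr : ∀ b, (r b + 1) * μ.real (F ⁻¹' {b}) ≤ μ.real ((π ∘ F) ⁻¹' {π b})) :
    ∀ᵐ x ∂μ, Real.log (r (F x) + 1) ≤ condInfo μ F π x := by
  filter_upwards [ae_measureReal_fiber_pos F] with x hx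
  have h1 : (0 : ℝ) < r (F x) + 1 := by positivity
  have := Real.log_le_log (by positivity) (hr (F x))
  rw [Real.log_mul h1.ne' hx.ne'] at this
  unfold condInfo
  linarith

end Rank

section Dynamics

variable {X : Type*} [MeasurableSpace X] {μ : Measure X}

theorem measurePreserving_zpow {T : Equiv.Perm X} (hT : MeasurePreserving T μ μ)
    (hT' : MeasurePreserving (⇑T⁻¹) μ μ) (n : ℤ) : MeasurePreserving (⇑(T ^ n)) μ μ := by
  cases n with
  | ofNat n =>
    rw [Int.ofNat_eq_natCast, zpow_natCast, ← Equiv.Perm.iterate_eq_pow]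
    exact hT.iterate n
  | negSucc n =>
    rw [zpow_negSucc, ← inv_pow, ← Equiv.Perm.iterate_eq_pow]
    exact hT'.iterate _

theorem ae_exists_iterate_mem [IsProbabilityMeasure μ] {f : X → X} (hf : Ergodic f μ) {A : Set X}
    (hA : MeasurableSet A) (hA0 : μ A ≠ 0) : ∀ᵐ x ∂μ, ∃ k, f^[k] x ∈ A := by
  have hm : MeasurableSet (⋃ k, f^[k] ⁻¹' A) :=
    .iUnion fun k => (hf.measurable.iterate k) hA
  have h := hf.ae_empty_or_univ_of_preimage_ae_le hm.nullMeasurableSet (by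
    refine Filter.Eventually.of_forall fun x hx => ?_
    simp only [Set.preimage_iUnion] at hx
    obtain ⟨k, hk⟩ := Set.mem_iUnion.1 hx
    exact Set.mem_iUnion.2 ⟨k + 1, by simpa using hk⟩)
  rcases h with h | h
  · refine absurd (measure_mono_null ?_ (ae_eq_empty.1 h)) hA0
    exact fun x hx => Set.mem_iUnion.2 ⟨0, hx⟩
  · filter_upwards [h] with x hx
    have : x ∈ ⋃ k, f^[k] ⁻¹' A := hx.mpr trivial
    simpa using this

/-- The time until the next visit to a positive-measure set decreases by one at each step,
outside a set with the same measure. -/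
theorem exists_countdown [IsProbabilityMeasure μ] {f : X → X} (hf : Ergodic f μ) {A : Set X}
    (hA : MeasurableSet A) (hA0 : μ A ≠ 0) :
    ∃ (A' : Set X) (t : X → ℕ), MeasurableSet A' ∧ μ A' = μ A ∧ Measurable t ∧
      ∀ x, x ∉ A' → t x = t (f x) + 1 := by
  classical
  set D : Set X := {x | ∀ j, f^[j] x ∉ A} with hD
  have hDm : MeasurableSet D := by
    have : D = ⋂ j, f^[j] ⁻¹' Aᶜ := by ext; simp [hD]
    rw [this]
    exact .iInter fun j => (hf.measurable.iterate j) hA.compl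
  have hD0 : μ D = 0 := by
    have := ae_exists_iterate_mem hf hA hA0
    rw [ae_iff] at this
    simpa [hD] using this
  let p : X → ℕ → Prop := fun x k => f^[k] x ∈ A ∨ x ∈ D
  have hp : ∀ x, ∃ k, p x k := fun x => by
    by_cases hx : x ∈ D
    · exact ⟨0, Or.inr hx⟩
    · simp only [hD, Set.mem_ofPred_eq, not_forall, not_not] at hx
      exact ⟨_, Or.inl hx.choose_spec⟩
  refine ⟨A ∪ D, fun x => Nat.find (hp x), hA.union hDm, ?_, ?_, ?_⟩
  · refine le_antisymm ((measure_union_le _ _).trans (by simp [hD0])) (measure_mono ?_)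
    exact Set.subset_union_left
  · exact measurable_find hp fun k => (hf.measurable.iterate k hA).union hDm
  · intro x hx
    simp only [Set.mem_union, not_or] at hx
    have hfx : f x ∉ D := fun h => hx.2 fun j => by
      cases j with
      | zero => exact hx.1
      | succ j => exact h j
    have hx1 : ∃ k, p x (k + 1) := (hp (f x)).imp fun k hk => Or.inl (hk.resolve_right hfx)
    refine (Nat.find_comp_succ (hp x) hx1 (by simp [p, hx])).trans ?_
    congr 1
    refine Nat.find_congr' fun {k} => ?_
    simp only [p, hx.2, hfx, or_false, Function.iterate_succ_apply]

end Dynamics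

/-- The cost of a message `j` sent at stage `k`; the message `0` is free. -/
noncomputable def messageCost (k j : ℕ) : ℝ :=
  if j = 0 then 0 else k * Real.log 2 + 2 * Real.log (j + 1)

theorem messageCost_nonneg (k j : ℕ) : 0 ≤ messageCost k j := by
  unfold messageCost
  split_ifs
  · rfl
  · have := Real.log_nonneg (x := (j : ℝ) + 1) (by linarith [j.cast_nonneg (α := ℝ)])
    have := Real.log_nonneg (x := 2) (by norm_num)
    positivity

theorem messageCost_le (k j : ℕ) : messageCost k j ≤ k * Real.log 2 + 2 * Real.log (j + 1) := by
  unfold messageCost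
  split_ifs
  · have := Real.log_nonneg (x := (j : ℝ) + 1) (by linarith [j.cast_nonneg (α := ℝ)])
    have := Real.log_nonneg (x := 2) (by norm_num)
    positivity
  · rfl

theorem exists_lt_add_mod_eq {n j : ℕ} (hj : j < n) (a : ℕ) : ∃ i < n, (a + i) % n = j := by
  have hn : 0 < n := by omega
  have hb := Nat.mod_lt a hn
  have ha := Nat.div_add_mod a n
  rcases le_or_gt (a % n) j with h | h
  · refine ⟨j - a % n, by omega, ?_⟩
    have : a + (j - a % n) = n * (a / n) + j := by omega
    rw [this, Nat.mul_add_mod, Nat.mod_eq_of_lt hj]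
  · refine ⟨n + j - a % n, by omega, ?_⟩
    have : a + (n + j - a % n) = n * (a / n + 1) + j := by rw [mul_add]; omega
    rw [this, Nat.mul_add_mod, Nat.mod_eq_of_lt hj]

section Stage

variable {X α : Type*} [MeasurableSpace X] {μ : Measure X} [IsProbabilityMeasure μ]
  [Fintype α] [MeasurableSpace α] [MeasurableSingletonClass α]

/-- A measurable set `F` visited by every orbit segment of length `n` outside a small set,
over which the integral of `g` is at most its average. -/
theorem exists_marker {T : Equiv.Perm X} (hT : Ergodic T μ)
    (hT' : Ergodic (⇑T⁻¹) μ)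
    (hsmall : ∀ ε : ℝ, 0 < ε → ∃ A, MeasurableSet A ∧ 0 < μ.real A ∧ μ.real A < ε)
    {n : ℕ} (hn : n ≠ 0) {g : X → ℝ} (hg : Integrable g μ) {ε : ℝ} (hε : 0 < ε) :
    ∃ F, MeasurableSet F ∧ ∫ x in F, g x ∂μ ≤ (∫ x, g x ∂μ) / n ∧
      μ.real {x | ∀ i < n, (T ^ (-(i : ℤ))) x ∉ F} ≤ ε := by
  have hn0 : (0 : ℝ) < n := by positivity
  obtain ⟨A, hA, hA0, hAε⟩ := hsmall (ε / n) (by positivity)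
  obtain ⟨A', t, hA', hμA', ht, htA'⟩ := exists_countdown hT hA
    (fun h => by simp [measureReal_def, h] at hA0)
  let F : Fin n → Set X := fun j => t ⁻¹' {k | k % n = j}
  have hF : ∀ j, MeasurableSet (F j) := fun j => ht (.of_discrete)
  have hsum : ∑ j, ∫ x in F j, g x ∂μ = ∫ x, g x ∂μ := by
    have hFu : ⋃ j, F j = Set.univ := Set.eq_univ_of_forall fun x => Set.mem_iUnion.2
      ⟨⟨t x % n, Nat.mod_lt _ (Nat.pos_of_ne_zero hn)⟩, rfl⟩
    rw [← integral_iUnion_fintype hF _ fun j => hg.integrableOn, hFu, setIntegral_univ]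
    intro i j hij
    refine Disjoint.preimage t (Set.disjoint_left.2 fun k hk hk' => hij ?_)
    simp only [Set.mem_ofPred_eq] at hk hk'
    exact Fin.ext (hk.symm.trans hk')
  have : Nonempty (Fin n) := ⟨⟨0, Nat.pos_of_ne_zero hn⟩⟩
  obtain ⟨j, -, hj⟩ := Finset.exists_le_of_sum_le
    (s := (Finset.univ : Finset (Fin n))) (f := fun j => ∫ x in F j, g x ∂μ)
    (g := fun _ => (∫ x, g x ∂μ) / n) Finset.univ_nonempty (by
      rw [hsum]
      simp only [Finset.sum_const, Finset.card_univ, Fintype.card_fin, nsmul_eq_mul]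
      exact le_of_eq (by field_simp))
  refine ⟨F j, hF j, hj, ?_⟩
  have hsub : {x | ∀ i < n, (T ^ (-(i : ℤ))) x ∉ F j} ⊆
      ⋃ i ∈ Finset.range n, ⇑(T ^ (-(i : ℤ))) ⁻¹' A' := by
    intro x hx
    by_contra hcon
    simp only [Set.mem_iUnion, Finset.mem_range, Set.mem_preimage, not_exists] at hcon
    have key : ∀ i < n, t ((T ^ (-(i : ℤ))) x) = t x + i := by
      intro i
      induction i with
      | zero => simp
      | succ i ih =>
        intro hi
        have h1 := htA' _ (hcon (i + 1) hi)
        have h2 : T ((T ^ (-((i + 1 : ℕ) : ℤ))) x) = (T ^ (-(i : ℤ))) x := by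
          rw [← Equiv.Perm.mul_apply, ← zpow_one_add]
          congr 2
          push_cast
          ring
        rw [h1, h2, ih (by omega)]
        ring
    obtain ⟨i, hi, hij⟩ := exists_lt_add_mod_eq j.2 (t x)
    refine hx i hi ?_
    simp only [F, Set.mem_preimage, Set.mem_ofPred_eq]
    rw [key i hi, hij]
  calc μ.real {x | ∀ i < n, (T ^ (-(i : ℤ))) x ∉ F j}
      ≤ μ.real (⋃ i ∈ Finset.range n, ⇑(T ^ (-(i : ℤ))) ⁻¹' A') :=
        measureReal_mono hsub (measure_ne_top _ _)
    _ ≤ ∑ i ∈ Finset.range n, μ.real (⇑(T ^ (-(i : ℤ))) ⁻¹' A') :=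
        measureReal_biUnion_finset_le _ _
    _ = ∑ i ∈ Finset.range n, μ.real A := Finset.sum_congr rfl fun i _ => by
        rw [measureReal_def, (measurePreserving_zpow hT.toMeasurePreserving
          hT'.toMeasurePreserving _).measure_preimage hA'.nullMeasurableSet, hμA', measureReal_def]
    _ = n * μ.real A := by simp
    _ ≤ n * (ε / n) := by gcongr
    _ = ε := by field_simp

/-- A sparse stream of messages that allows to recover the observable `b` from the observable
`q`, at a cost controlled by the increase of entropy. -/
theorem exists_messages {T : Equiv.Perm X} (hT : Ergodic T μ)
    (hT' : Ergodic (⇑T⁻¹) μ)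
    (hsmall : ∀ ε : ℝ, 0 < ε → ∃ A, MeasurableSet A ∧ 0 < μ.real A ∧ μ.real A < ε)
    {q : X → α} (hq : Measurable q) {b : X → Bool} (hb : Measurable b) {h h' : ℝ}
    (hh : Tendsto (fun n : ℕ => rvEntropy μ (word T q n) / n) atTop (nhds h))
    (hh' : Tendsto (fun n : ℕ => rvEntropy μ (word T (fun x => (q x, b x)) n) / n)
      atTop (nhds h')) (k : ℕ) {ε : ℝ} (hε : 0 < ε) :
    ∃ m : X → ℕ, Measurable m ∧
      (∀ x y, (∀ n : ℤ, q ((T ^ n) x) = q ((T ^ n) y)) →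
        (∀ n : ℤ, m ((T ^ n) x) = m ((T ^ n) y)) → b x = b y) ∧
      ∫⁻ x, ENNReal.ofReal (messageCost k (m x)) ∂μ ≤ ENNReal.ofReal (2 * (h' - h) + ε) := by
  classical
  set q' : X → α × Bool := fun x => (q x, b x) with hq'def
  have hq' : Measurable q' := hq.prodMk hb
  set c : ℝ := k * Real.log 2 + 2 * Real.log 4 with hc
  have hc0 : 0 < c := by
    have := Real.log_pos (x := 2) (by norm_num)
    have := Real.log_pos (x := 4) (by norm_num)
    positivity
  obtain ⟨n, hn, hn0⟩ : ∃ n : ℕ, (c + 2 * (rvEntropy μ (word T q' n) -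
      rvEntropy μ (word T q n))) / n < 2 * (h' - h) + ε / 2 ∧ n ≠ 0 := by
    have h1 : Tendsto (fun n : ℕ => (c + 2 * (rvEntropy μ (word T q' n) -
        rvEntropy μ (word T q n))) / n) atTop (nhds (0 + 2 * (h' - h))) := by
      have := (tendsto_const_div_atTop_nhds_zero_nat c).add ((hh'.sub hh).const_mul 2)
      refine this.congr fun n => ?_
      ring
    exact ((h1.eventually_lt_const (by linarith)).and (eventually_ne_atTop 0)).exists
  let π : (Fin n → α × Bool) → Fin n → α := fun w i => (w i).1
  set W := word T q' n with hW
  have hWm : Measurable W := measurable_word hT.measurable hq' n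
  have hπW : π ∘ W = word T q n := rfl
  obtain ⟨r, hr, hrW⟩ := exists_conditional_rank (μ := μ) hWm π
  have hlog := log_rank_le_condInfo hrW
  set g : X → ℝ := fun x => c + 2 * condInfo μ W π x with hg
  have hgi : Integrable g μ :=
    (integrable_const c).add ((integrable_condInfo hWm π).const_mul 2)
  have hgint : ∫ x, g x ∂μ = c + 2 * (rvEntropy μ W - rvEntropy μ (word T q n)) := by
    rw [hg, integral_add (integrable_const c) ((integrable_condInfo hWm π).const_mul 2),
      integral_const_mul, integral_condInfo hWm π, hπW]
    simp
  obtain ⟨F, hF, hFg, hexc⟩ := exists_marker hT hT' hsmall hn0 hgi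
    (show 0 < ε / (2 * c) by positivity)
  set D : Set X := {x | ∀ i < n, (T ^ (-(i : ℤ))) x ∉ F} with hD
  have hDm : MeasurableSet D := by
    have : D = ⋂ i, ⋂ (_ : i < n), ⇑(T ^ (-(i : ℤ))) ⁻¹' Fᶜ := by
      ext
      simp [hD]
    rw [this]
    exact .iInter fun i => .iInter fun _ => (measurePreserving_zpow hT.toMeasurePreserving
          hT'.toMeasurePreserving _).measurable hF.compl
  let m : X → ℕ := fun x =>
    if x ∈ F then r (W x) + 3 else if x ∈ D then (if b x = true then 2 else 1) else 0
  have hm : Measurable m := by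
    refine Measurable.ite hF ((measurable_of_finite fun w => r w + 3).comp hWm) ?_
    exact Measurable.ite hDm (Measurable.ite (hb (measurableSet_singleton true))
      measurable_const measurable_const) measurable_const
  have hmF : ∀ x, x ∈ F ↔ 3 ≤ m x := fun x => by
    simp only [m]
    split_ifs <;> simp_all
  refine ⟨m, hm, ?_, ?_⟩
  · intro x y hqxy hmxy
    have hFxy : ∀ l : ℤ, (T ^ l) x ∈ F ↔ (T ^ l) y ∈ F := fun l => by
      rw [hmF, hmF, hmxy]
    have hDxy : x ∈ D ↔ y ∈ D := by
      simp only [hD, Set.mem_ofPred_eq, hFxy]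
    by_cases hx : x ∈ D
    · have hxF : x ∉ F := by simpa using hx 0 (Nat.pos_of_ne_zero hn0)
      have hyF : y ∉ F := fun hy => hxF ((hFxy 0).2 hy)
      have := hmxy 0
      simp only [m, zpow_zero, Equiv.Perm.one_apply, if_neg hxF, if_neg hyF, if_pos hx,
        if_pos (hDxy.1 hx)] at this
      cases hbx : b x <;> cases hby : b y <;> simp_all
    · simp only [hD, Set.mem_ofPred_eq, not_forall, not_not] at hx
      obtain ⟨i, hi, hix⟩ := hx
      have hiy := (hFxy _).1 hix
      have hmi := hmxy (-(i : ℤ))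
      simp only [m, if_pos hix, if_pos hiy, Nat.add_right_cancel_iff] at hmi
      have hit : ∀ (z : X) (j : ℕ) (l : ℤ), T^[j] ((T ^ l) z) = (T ^ (j + l)) z := by
        intro z j l
        rw [Equiv.Perm.iterate_eq_pow, ← zpow_natCast, ← Equiv.Perm.mul_apply, ← zpow_add]
      have hπ : π (W ((T ^ (-(i : ℤ))) x)) = π (W ((T ^ (-(i : ℤ))) y)) := by
        funext j
        simp only [π, hW, word, hq'def, hit, hqxy]
      have hWxy := congrFun (hr _ _ hπ hmi) ⟨i, hi⟩
      simp only [hW, word, hq'def, hit, add_neg_cancel, zpow_zero, Equiv.Perm.one_apply,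
        Prod.mk.injEq] at hWxy
      exact hWxy.2
  · have hbound : ∀ᵐ x ∂μ, messageCost k (m x) ≤ F.indicator g x + D.indicator (fun _ => c) x := by
      filter_upwards [hlog] with x hx
      have hc1 : k * Real.log 2 + 2 * Real.log 4 ≤ c := le_rfl
      by_cases hxF : x ∈ F
      · have hxD : x ∉ D := fun h => by
          have := h 0 (Nat.pos_of_ne_zero hn0)
          simp_all
        rw [Set.indicator_of_mem hxF, Set.indicator_of_notMem hxD]
        have hmx : m x = r (W x) + 3 := if_pos hxF
        refine (messageCost_le _ _).trans ?_
        have h4 : Real.log ((m x : ℝ) + 1) ≤ Real.log 4 + Real.log (r (W x) + 1) := by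
          rw [← Real.log_mul (by norm_num) (by positivity), hmx]
          refine Real.log_le_log (by positivity) ?_
          push_cast
          linarith [(r (W x)).cast_nonneg (α := ℝ)]
        simp only [hg]
        linarith
      · rw [Set.indicator_of_notMem hxF]
        by_cases hxD : x ∈ D
        · rw [Set.indicator_of_mem hxD]
          refine (messageCost_le _ _).trans ?_
          have hmx : m x ≤ 3 := by
            have := (hmF x).not.1 hxF
            omega
          have h4 : Real.log ((m x : ℝ) + 1) ≤ Real.log 4 := by
            refine Real.log_le_log (by positivity) ?_
            have : (m x : ℝ) ≤ 3 := by exact_mod_cast hmx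
            linarith
          linarith
        · have hmx : m x = 0 := by simp [m, hxF, hxD]
          rw [Set.indicator_of_notMem hxD, hmx]
          simp [messageCost]
    have hi1 : Integrable (F.indicator g) μ := hgi.indicator hF
    have hi2 : Integrable (D.indicator fun _ => c) μ := (integrable_const c).indicator hDm
    have hInt : ∫ x, (F.indicator g x + D.indicator (fun _ => c) x) ∂μ ≤ 2 * (h' - h) + ε := by
      rw [integral_add hi1 hi2, integral_indicator hF, integral_indicator hDm]
      have h1 : ∫ x in D, c ∂μ ≤ ε / 2 := by
        rw [setIntegral_const, smul_eq_mul]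
        calc μ.real D * c ≤ ε / (2 * c) * c := by gcongr
          _ = ε / 2 := by field_simp
      rw [hgint] at hFg
      linarith
    calc ∫⁻ x, ENNReal.ofReal (messageCost k (m x)) ∂μ
        ≤ ∫⁻ x, ENNReal.ofReal (F.indicator g x + D.indicator (fun _ => c) x) ∂μ :=
          lintegral_mono_ae (hbound.mono fun x hx => ENNReal.ofReal_le_ofReal hx)
      _ = ENNReal.ofReal (∫ x, (F.indicator g x + D.indicator (fun _ => c) x) ∂μ) :=
          (ofReal_integral_eq_lintegral_ofReal (hi1.add hi2)
            (hbound.mono fun x hx => (messageCost_nonneg _ _).trans hx)).symm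
      _ ≤ _ := ENNReal.ofReal_le_ofReal hInt

end Stage

section Total

variable {X : Type*} [MeasurableSpace X] {μ : Measure X} [IsProbabilityMeasure μ]

theorem rvEntropy_comp_le {α β : Type*}
    [Fintype α] [MeasurableSpace α] [MeasurableSingletonClass α]
    [Fintype β] [MeasurableSpace β] [MeasurableSingletonClass β]
    {F : X → β} (hF : Measurable F) (π : β → α) :
    rvEntropy μ (π ∘ F) ≤ rvEntropy μ F := by
  obtain ⟨r, -, hr⟩ := exists_conditional_rank (μ := μ) hF π
  have : 0 ≤ ∫ x, condInfo μ F π x ∂μ := by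
    refine integral_nonneg_of_ae ?_
    filter_upwards [log_rank_le_condInfo hr] with x hx
    refine le_trans (Real.log_nonneg ?_) hx
    linarith [(r (F x)).cast_nonneg (α := ℝ)]
  rw [integral_condInfo hF] at this
  linarith

/-- A sequence of observables separating points can be recovered from a family of messages with
finite total expected cost, when the entropy is finite. -/
theorem exists_messages_of_separating {T : Equiv.Perm X} (hT : Ergodic T μ)
    (hT' : Ergodic (⇑T⁻¹) μ)
    (hsmall : ∀ ε : ℝ, 0 < ε → ∃ A, MeasurableSet A ∧ 0 < μ.real A ∧ μ.real A < ε)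
    {b : ℕ → X → Bool} (hb : ∀ k, Measurable (b k))
    (hsep : ∀ x y, (∀ k, b k x = b k y) → x = y) {C : ℝ}
    (hC : ∀ (k : ℕ) (q : X → Fin k → Bool), Measurable q → ∀ h : ℝ,
      Tendsto (fun n : ℕ => rvEntropy μ (word T q n) / n) atTop (nhds h) → h ≤ C) :
    ∃ m : ℕ → X → ℕ, (∀ k, Measurable (m k)) ∧
      (∀ x y, (∀ k, ∀ n : ℤ, m k ((T ^ n) x) = m k ((T ^ n) y)) → x = y) ∧
      ∫⁻ x, ∑' k, ENNReal.ofReal (messageCost k (m k x)) ∂μ ≠ ⊤ := by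
  let p : (k : ℕ) → X → Fin k → Bool := fun k x i => b i x
  have hp : ∀ k, Measurable (p k) := fun k => measurable_pi_lambda _ fun i => hb i
  choose h hh0 hh using fun k => exists_entropyRate hT.toMeasurePreserving (hp k)
  have hword : ∀ k n, rvEntropy μ (word T (fun x => (p k x, b k x)) n) =
      rvEntropy μ (word T (p (k + 1)) n) := by
    intro k n
    let e : (Fin k → Bool) × Bool ≃ (Fin (k + 1) → Bool) :=
      (Equiv.prodComm _ _).trans (Fin.snocEquiv fun _ : Fin (k + 1) => Bool)
    rw [← rvEntropy_equiv_comp (Equiv.arrowCongr (Equiv.refl (Fin n)) e)]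
    congr 1
    ext x j i
    simp only [Function.comp_apply, Equiv.arrowCongr_apply, Equiv.refl_symm, Equiv.coe_refl, id,
      word, e, Equiv.trans_apply, Equiv.prodComm_apply, Prod.swap_prod_mk, Fin.snocEquiv, p,
      Equiv.coe_fn_mk]
    refine Fin.lastCases ?_ (fun i => ?_) i <;> simp
  have hmono : ∀ k, h k ≤ h (k + 1) := by
    intro k
    refine le_of_tendsto_of_tendsto' (hh k) (hh (k + 1)) fun n => ?_
    gcongr
    exact rvEntropy_comp_le (measurable_word hT.measurable (hp (k + 1)) n)
      fun (w : Fin n → Fin (k + 1) → Bool) j (i : Fin k) => w j i.castSucc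
  choose m hm hdec hcost using fun k => exists_messages hT hT' hsmall (hp k) (hb k) (hh k)
    ((hh (k + 1)).congr fun n => by rw [hword]) k
    (show (0 : ℝ) < (1 / 2) ^ k by positivity)
  refine ⟨m, hm, fun x y hxy => ?_, ?_⟩
  · have hall : ∀ k, ∀ n : ℤ, b k ((T ^ n) x) = b k ((T ^ n) y) := by
      intro k
      induction k using Nat.strong_induction_on with
      | _ k ih =>
        intro n
        have hz : ∀ (z : X) (l : ℤ), (T ^ l) ((T ^ n) z) = (T ^ (l + n)) z := fun z l => by
          rw [← Equiv.Perm.mul_apply, ← zpow_add]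
        refine hdec k _ _ (fun l => ?_) fun l => ?_
        · funext i
          rw [hz, hz]
          exact ih i i.2 (l + n)
        · rw [hz, hz, hxy]
    exact hsep x y fun k => by simpa using hall k 0
  · have hcm : ∀ k, Measurable fun x => ENNReal.ofReal (messageCost k (m k x)) := fun k =>
      ((measurable_of_countable (messageCost k)).comp (hm k)).ennreal_ofReal
    rw [lintegral_tsum fun k => (hcm k).aemeasurable]
    have hpos : ∀ k, 0 ≤ 2 * (h (k + 1) - h k) + (1 / 2 : ℝ) ^ k := fun k => by
      have := hmono k
      have : (0 : ℝ) ≤ (1 / 2) ^ k := by positivity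
      linarith
    refine ne_top_of_le_ne_top (ENNReal.ofReal_ne_top (r := 2 * C + 2)) ?_
    refine ENNReal.tsum_le_of_sum_range_le fun N => ?_
    refine (Finset.sum_le_sum fun k _ => hcost k).trans ?_
    rw [← ENNReal.ofReal_sum_of_nonneg fun k _ => hpos k]
    refine ENNReal.ofReal_le_ofReal ?_
    rw [Finset.sum_add_distrib, ← Finset.mul_sum, Finset.sum_range_sub]
    have h1 := hC N (p N) (hp N) (h N) (hh N)
    have h2 := hh0 0
    have h3 : ∑ k ∈ Finset.range N, (1 / 2 : ℝ) ^ k ≤ 2 := sum_geometric_two_le N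
    linarith

end Total

section Maximal

variable {X : Type*} [MeasurableSpace X] {μ : Measure X}

/-- The running maximum of the Birkhoff sums of `f`. -/
noncomputable def birkhoffMax (T : X → X) (f : X → ℝ) : ℕ → X → ℝ
  | 0 => fun _ => 0
  | n + 1 => fun x => max 0 (f x + birkhoffMax T f n (T x))

omit [MeasurableSpace X] in
theorem birkhoffMax_nonneg (T : X → X) (f : X → ℝ) (n : ℕ) (x : X) : 0 ≤ birkhoffMax T f n x := by
  cases n with
  | zero => exact le_rfl
  | succ n => exact le_max_left _ _

omit [MeasurableSpace X] in
theorem birkhoffMax_le_succ (T : X → X) (f : X → ℝ) (n : ℕ) :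
    ∀ x, birkhoffMax T f n x ≤ birkhoffMax T f (n + 1) x := by
  induction n with
  | zero => exact fun x => le_max_left _ _
  | succ n ih =>
    intro x
    have := ih (T x)
    simp only [birkhoffMax] at this ⊢
    gcongr

omit [MeasurableSpace X] in
theorem birkhoffSum_le_birkhoffMax (T : X → X) (f : X → ℝ) (n : ℕ) :
    ∀ x, birkhoffSum T f n x ≤ birkhoffMax T f n x := by
  induction n with
  | zero => exact fun x => le_rfl
  | succ n ih =>
    intro x
    rw [birkhoffSum_succ']
    exact (add_le_add_right (ih (T x)) _).trans (le_max_right _ _)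

theorem integrable_birkhoffMax {T : X → X} (hT : MeasurePreserving T μ μ) {f : X → ℝ}
    (hf : Integrable f μ) (n : ℕ) : Integrable (birkhoffMax T f n) μ := by
  induction n with
  | zero => exact integrable_zero _ _ _
  | succ n ih => exact (integrable_zero X ℝ μ).sup (hf.add (hT.integrable_comp_of_integrable ih))

theorem measurable_birkhoffMax {T : X → X} (hT : Measurable T) {f : X → ℝ}
    (hf : Measurable f) (n : ℕ) : Measurable (birkhoffMax T f n) := by
  induction n with
  | zero => exact measurable_const
  | succ n ih => exact measurable_const.max (hf.add (ih.comp hT))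

theorem setIntegral_birkhoffMax_pos_nonneg {T : X → X} (hT : MeasurePreserving T μ μ) {f : X → ℝ}
    (hf : Integrable f μ) (hfm : Measurable f) (n : ℕ) :
    0 ≤ ∫ x in {x | 0 < birkhoffMax T f n x}, f x ∂μ := by
  cases n with
  | zero => simp [birkhoffMax]
  | succ n =>
    set A := {x | 0 < birkhoffMax T f (n + 1) x} with hA
    have hAm : MeasurableSet A :=
      measurableSet_lt measurable_const (measurable_birkhoffMax hT.measurable hfm _)
    have h1 := integrable_birkhoffMax hT hf (n + 1)
    have h0 := integrable_birkhoffMax hT hf n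
    have h2 : Integrable (fun x => birkhoffMax T f n (T x)) μ :=
      hT.integrable_comp_of_integrable h0
    have h3 : ∫ x in A, birkhoffMax T f (n + 1) x ∂μ = ∫ x, birkhoffMax T f (n + 1) x ∂μ :=
      setIntegral_eq_integral_of_forall_compl_eq_zero fun x hx =>
        le_antisymm (not_lt.1 hx) (birkhoffMax_nonneg _ _ _ _)
    have h4 : ∫ x in A, birkhoffMax T f n (T x) ∂μ ≤ ∫ x, birkhoffMax T f n (T x) ∂μ :=
      setIntegral_le_integral h2 (Eventually.of_forall fun x => birkhoffMax_nonneg _ _ _ _)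
    have h5 : ∫ x, birkhoffMax T f n (T x) ∂μ = ∫ x, birkhoffMax T f n x ∂μ := by
      conv_rhs => rw [← hT.map_eq]
      rw [integral_map hT.measurable.aemeasurable
        (measurable_birkhoffMax hT.measurable hfm _).aestronglyMeasurable]
    have h6 : ∫ x, birkhoffMax T f n x ∂μ ≤ ∫ x, birkhoffMax T f (n + 1) x ∂μ :=
      integral_mono h0 h1 (birkhoffMax_le_succ T f n)
    have h7 : ∫ x in A, f x ∂μ = ∫ x in A, (birkhoffMax T f (n + 1) x -
        birkhoffMax T f n (T x)) ∂μ := by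
      refine setIntegral_congr_fun hAm fun x hx => ?_
      simp only [hA, Set.mem_ofPred_eq, birkhoffMax, lt_max_iff, lt_irrefl, false_or] at hx ⊢
      rw [max_eq_right hx.le]
      ring
    rw [h7, integral_sub h1.integrableOn h2.integrableOn]
    linarith

/-- A consequence of the maximal ergodic theorem: if `∫ f < 0`, then with positive probability
all Birkhoff sums of `f` are nonpositive. -/
theorem measure_birkhoffSum_nonpos_ne_zero {T : X → X} (hT : MeasurePreserving T μ μ) {f : X → ℝ}
    (hf : Integrable f μ) (hfm : Measurable f) (hneg : ∫ x, f x ∂μ < 0) :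
    μ {x | ∀ n, birkhoffSum T f n x ≤ 0} ≠ 0 := by
  intro h0
  set A : ℕ → Set X := fun n => {x | 0 < birkhoffMax T f n x} with hA
  have hAm : ∀ n, MeasurableSet (A n) := fun n =>
      measurableSet_lt measurable_const (measurable_birkhoffMax hT.measurable hfm _)
  have hmono : Monotone A :=
    monotone_nat_of_le_succ fun n x hx => lt_of_lt_of_le hx (birkhoffMax_le_succ T f n x)
  have hcover : (⋃ n, A n) =ᵐ[μ] Set.univ := by
    rw [eventuallyEq_univ]
    filter_upwards [measure_eq_zero_iff_ae_notMem.1 h0] with x hx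
    simp only [not_forall, not_le] at hx
    obtain ⟨n, hn⟩ := hx
    exact Set.mem_iUnion.2 ⟨n, hn.trans_le (birkhoffSum_le_birkhoffMax T f n x)⟩
  have hlim := tendsto_setIntegral_of_monotone hAm hmono hf.integrableOn
  rw [setIntegral_congr_set hcover, setIntegral_univ] at hlim
  exact hneg.not_ge (ge_of_tendsto' hlim fun n => setIntegral_birkhoffMax_pos_nonneg hT hf hfm n)

end Maximal

theorem sum_exp_neg_messageCost_le (k J : ℕ) :
    ∑ j ∈ Finset.range J, Real.exp (-messageCost k j) ≤ Real.exp ((1 / 2) ^ k) := by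
  have key : ∀ J : ℕ, ∑ j ∈ Finset.range (J + 1), Real.exp (-messageCost k j) ≤
      1 + (1 / 2) ^ k * (1 - 1 / (J + 1)) := by
    intro J
    induction J with
    | zero => simp [messageCost]
    | succ J ih =>
      rw [Finset.sum_range_succ]
      have h1 : Real.exp (-messageCost k (J + 1)) = (1 / 2) ^ k * (1 / ((J : ℝ) + 2) ^ 2) := by
        have h2 : (0 : ℝ) < (J : ℝ) + 2 := by positivity
        rw [messageCost, if_neg (by omega), neg_add, Real.exp_add, Real.exp_neg, Real.exp_neg,
          Real.exp_nat_mul, Real.exp_log (by norm_num)]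
        push_cast
        rw [show ((J : ℝ) + 1 + 1) = J + 2 by ring,
          show (2 : ℝ) * Real.log (J + 2) = (2 : ℕ) * Real.log (J + 2) by norm_num,
          Real.exp_nat_mul, Real.exp_log h2]
        simp
      have h3 : 1 / ((J : ℝ) + 2) ^ 2 ≤ 1 / ((J : ℝ) + 1) - 1 / (J + 2) := by
        rw [div_sub_div _ _ (by positivity) (by positivity),
          div_le_div_iff₀ (by positivity) (by positivity)]
        nlinarith [(J.cast_nonneg : (0 : ℝ) ≤ J)]
      have h4 : (0 : ℝ) ≤ (1 / 2) ^ k := by positivity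
      have h5 := mul_le_mul_of_nonneg_left h3 h4
      rw [h1]
      push_cast
      rw [show ((J : ℝ) + 1 + 1) = J + 2 by ring]
      linarith
  have h0 : ∑ j ∈ Finset.range J, Real.exp (-messageCost k j) ≤
      ∑ j ∈ Finset.range (J + 1), Real.exp (-messageCost k j) :=
    Finset.sum_le_sum_of_subset_of_nonneg (Finset.range_mono (Nat.le_succ J))
      fun _ _ _ => (Real.exp_pos _).le
  have h1 : (0 : ℝ) ≤ (1 / 2) ^ k * (1 / ((J : ℝ) + 1)) := by positivity
  have h2 := Real.add_one_le_exp ((1 / 2 : ℝ) ^ k)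
  have h3 := key J
  linarith

theorem sum_exp_neg_sum_messageCost_le {ι : Type*} [Fintype ι] (κ : ι → ℕ)
    (S : Finset (ι → ℕ)) :
    ∑ Ψ ∈ S, Real.exp (-∑ i, messageCost (κ i) (Ψ i)) ≤ Real.exp (∑ i, (1 / 2) ^ κ i) := by
  classical
  set J := S.sup (fun Ψ => Finset.univ.sup Ψ) + 1 with hJ
  have hS : S ⊆ Fintype.piFinset fun _ : ι => Finset.range J := by
    intro Ψ hΨ
    rw [Fintype.mem_piFinset]
    intro i
    rw [Finset.mem_range, hJ, Nat.lt_succ_iff]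
    exact (Finset.le_sup (f := Ψ) (Finset.mem_univ i)).trans
      (Finset.le_sup (f := fun Ψ : ι → ℕ => Finset.univ.sup Ψ) hΨ)
  calc ∑ Ψ ∈ S, Real.exp (-∑ i, messageCost (κ i) (Ψ i))
      ≤ ∑ Ψ ∈ Fintype.piFinset fun _ : ι => Finset.range J,
          Real.exp (-∑ i, messageCost (κ i) (Ψ i)) :=
        Finset.sum_le_sum_of_subset_of_nonneg hS fun _ _ _ => (Real.exp_pos _).le
    _ = ∏ i, ∑ j ∈ Finset.range J, Real.exp (-messageCost (κ i) j) := by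
        rw [Finset.prod_univ_sum]
        refine Finset.sum_congr rfl fun Ψ _ => ?_
        rw [← Finset.sum_neg_distrib, Real.exp_sum]
    _ ≤ ∏ i, Real.exp ((1 / 2) ^ κ i) :=
        Finset.prod_le_prod (fun i _ => Finset.sum_nonneg fun _ _ => (Real.exp_pos _).le)
          fun i _ => sum_exp_neg_messageCost_le _ _
    _ = Real.exp (∑ i, (1 / 2) ^ κ i) := (Real.exp_sum _ _).symm

/-- The blocks of messages of length `r` whose total cost is at most `R`. -/
def affordableBlocks (r : ℕ) (R : ℝ) : Set (Fin r → ℕ → ℕ) :=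
  {Φ | ∀ N : ℕ, ∑ i, ∑ k : Fin N, messageCost k (Φ i k) ≤ R}

theorem card_le_of_subset_affordableBlocks {r : ℕ} {R : ℝ} (S : Finset (Fin r → ℕ → ℕ))
    (hS : ∀ Φ ∈ S, Φ ∈ affordableBlocks r R) : (S.card : ℝ) ≤ Real.exp (2 * r + R) := by
  classical
  have hex : ∀ P : (Fin r → ℕ → ℕ) × (Fin r → ℕ → ℕ), ∃ k, P.1 ≠ P.2 → ∃ i, P.1 i k ≠ P.2 i k := by
    intro P
    by_cases h : P.1 = P.2
    · exact ⟨0, fun h' => absurd h h'⟩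
    · obtain ⟨i, hi⟩ := Function.ne_iff.1 h
      obtain ⟨k, hk⟩ := Function.ne_iff.1 hi
      exact ⟨k, fun _ => ⟨i, hk⟩⟩
  choose d hd using hex
  set N := (S ×ˢ S).sup d + 1 with hN
  let ρ : (Fin r → ℕ → ℕ) → Fin r × Fin N → ℕ := fun Φ ik => Φ ik.1 ik.2
  have hρ : Set.InjOn ρ S := by
    intro Φ hΦ Φ' hΦ' h
    by_contra hne
    obtain ⟨i, hi⟩ := hd (Φ, Φ') hne
    have hlt : d (Φ, Φ') < N := by
      rw [hN, Nat.lt_succ_iff]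
      exact Finset.le_sup (Finset.mk_mem_product hΦ hΦ')
    exact hi (congrFun h (i, ⟨_, hlt⟩))
  have h1 := sum_exp_neg_sum_messageCost_le (fun ik : Fin r × Fin N => (ik.2 : ℕ)) (S.image ρ)
  rw [Finset.sum_image hρ] at h1
  have h2 : (S.card : ℝ) * Real.exp (-R) ≤
      ∑ Φ ∈ S, Real.exp (-∑ ik : Fin r × Fin N, messageCost ik.2 (ρ Φ ik)) := by
    rw [← nsmul_eq_mul]
    refine Finset.card_nsmul_le_sum _ _ _ fun Φ hΦ => ?_
    refine Real.exp_le_exp.2 (neg_le_neg ?_)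
    rw [Fintype.sum_prod_type]
    exact hS Φ hΦ N
  have h3 : ∑ ik : Fin r × Fin N, (1 / 2 : ℝ) ^ (ik.2 : ℕ) ≤ 2 * r := by
    rw [Fintype.sum_prod_type]
    simp only [Finset.sum_const, Finset.card_univ, Fintype.card_fin, nsmul_eq_mul]
    rw [Fin.sum_univ_eq_sum_range fun k => (1 / 2 : ℝ) ^ k]
    nlinarith [sum_geometric_two_le N, (r.cast_nonneg : (0 : ℝ) ≤ r)]
  have h4 := (h2.trans h1).trans (Real.exp_le_exp.2 h3)
  rw [Real.exp_add]
  calc (S.card : ℝ) = S.card * Real.exp (-R) * Real.exp R := by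
        rw [mul_assoc, ← Real.exp_add]
        simp
    _ ≤ _ := by gcongr

theorem finite_affordableBlocks (r : ℕ) (R : ℝ) : (affordableBlocks r R).Finite := by
  by_contra h
  obtain ⟨S, hS, hcard⟩ := Set.Infinite.exists_subset_card_eq h (⌊Real.exp (2 * r + R)⌋₊ + 1)
  have := card_le_of_subset_affordableBlocks S fun Φ hΦ => hS hΦ
  rw [hcard] at this
  push_cast at this
  exact absurd (Nat.lt_floor_add_one (Real.exp (2 * r + R))) this.not_gt

/-- Affordable blocks of length `r` inject into words of length `r` over a finite alphabet. -/
theorem exists_blockCode (K : ℝ) : ∃ A : ℕ, ∀ r : ℕ,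
    ∃ e : (Fin r → ℕ → ℕ) → Fin r → Fin (A + 1), Measurable e ∧
      Set.InjOn e (affordableBlocks r (K * r)) := by
  classical
  refine ⟨⌈Real.exp (2 + K)⌉₊, fun r => ?_⟩
  set A := ⌈Real.exp (2 + K)⌉₊ with hA
  set W := affordableBlocks r (K * r) with hW
  have hfin : W.Finite := finite_affordableBlocks _ _
  have : Fintype W := hfin.fintype
  have hcard : Fintype.card W ≤ Fintype.card (Fin r → Fin (A + 1)) := by
    rw [← Set.toFinset_card]
    have h1 := card_le_of_subset_affordableBlocks W.toFinset fun Φ hΦ => Set.mem_toFinset.1 hΦ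
    have h2 : Real.exp (2 * r + K * r) ≤ ((A + 1 : ℕ) : ℝ) ^ r := by
      rw [← add_mul, mul_comm, Real.exp_nat_mul]
      gcongr
      push_cast
      linarith [Nat.le_ceil (Real.exp (2 + K))]
    rw [Fintype.card_fun, Fintype.card_fin, Fintype.card_fin]
    exact_mod_cast h1.trans h2
  obtain ⟨g⟩ := Function.Embedding.nonempty_of_card_le hcard
  refine ⟨fun Φ => if h : Φ ∈ W then g ⟨Φ, h⟩ else 0, ?_, fun Φ hΦ Φ' hΦ' h => ?_⟩
  · refine measurable_of_restrict_of_restrict_compl hfin.measurableSet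
      (measurable_of_countable _) ?_
    have : Wᶜ.domRestrict (fun Φ => if h : Φ ∈ W then g ⟨Φ, h⟩ else 0) = fun _ => 0 := by
      funext Φ
      exact dif_neg Φ.2
    rw [this]
    exact measurable_const
  · simp only [dif_pos hΦ, dif_pos hΦ'] at h
    simpa using g.injective h

theorem measurable_sInf_nat {X : Type*} [MeasurableSpace X] {p : X → ℕ → Prop}
    (hp : ∀ k, MeasurableSet {x | p x k}) : Measurable fun x => sInf {k | p x k} := by
  classical
  have hD : MeasurableSet {x | ∀ j, ¬ p x j} := by
    have : {x | ∀ j, ¬ p x j} = ⋂ j, {x | p x j}ᶜ := by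
      ext
      simp
    rw [this]
    exact .iInter fun j => (hp j).compl
  have hq : ∀ x, ∃ k, p x k ∨ ∀ j, ¬ p x j := fun x => by
    by_cases h : ∃ k, p x k
    · exact h.imp fun k => Or.inl
    · exact ⟨0, Or.inr (not_exists.1 h)⟩
  have : (fun x => sInf {k | p x k}) = fun x => Nat.find (hq x) := by
    funext x
    by_cases h : ∃ k, p x k
    · refine (Nat.sInf_def (s := {k | p x k}) h).trans (Nat.find_congr' fun {k} => ?_)
      exact ⟨Or.inl, fun h' => h'.resolve_right fun h'' => h''  _ h.choose_spec⟩
    · have h1 : {k | p x k} = ∅ := Set.eq_empty_of_forall_notMem (not_exists.1 h)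
      rw [h1, Nat.sInf_empty, eq_comm, Nat.find_eq_zero]
      exact Or.inr (not_exists.1 h)
  rw [this]
  exact measurable_find hq fun k => (hp k).union hD

section Coding

variable {X : Type*}

/-- The time elapsed since the last visit to `E`. -/
noncomputable def lastVisit (T : Equiv.Perm X) (E : Set X) (x : X) : ℕ :=
  sInf {k : ℕ | (T ^ (-(k : ℤ))) x ∈ E}

/-- The first return time to `E`. -/
noncomputable def returnTime (T : Equiv.Perm X) (E : Set X) (x : X) : ℕ :=
  sInf {k : ℕ | (T ^ ((k : ℤ) + 1)) x ∈ E} + 1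

/-- The digit at position `s` of the encoded block of messages of length `r` starting at `x`. -/
noncomputable def blockDigit (T : Equiv.Perm X) (m : ℕ → X → ℕ) {A : ℕ}
    (e : (r : ℕ) → (Fin r → ℕ → ℕ) → Fin r → Fin (A + 1)) (r s : ℕ) (x : X) : Fin (A + 1) :=
  if h : s < r then e r (fun i k => m k ((T ^ ((i : ℕ) : ℤ)) x)) ⟨s, h⟩ else 0

/-- Every orbit segment between two visits to `E` carries the code of its block of messages. -/
noncomputable def orbitDigit (T : Equiv.Perm X) (m : ℕ → X → ℕ) {A : ℕ}
    (e : (r : ℕ) → (Fin r → ℕ → ℕ) → Fin r → Fin (A + 1)) (E : Set X) (x : X) : Fin (A + 1) :=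
  blockDigit T m e (returnTime T E ((T ^ (-(lastVisit T E x : ℤ))) x)) (lastVisit T E x)
    ((T ^ (-(lastVisit T E x : ℤ))) x)

theorem zpow_apply_zpow (T : Equiv.Perm X) (a b : ℤ) (x : X) :
    (T ^ a) ((T ^ b) x) = (T ^ (a + b)) x := by
  rw [← Equiv.Perm.mul_apply, ← zpow_add]

theorem lastVisit_mem {T : Equiv.Perm X} {E : Set X} {x : X}
    (hx : ∃ k : ℕ, (T ^ (-(k : ℤ))) x ∈ E) : (T ^ (-(lastVisit T E x : ℤ))) x ∈ E :=
  Nat.sInf_mem (s := {k : ℕ | (T ^ (-(k : ℤ))) x ∈ E}) hx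

theorem returnTime_mem {T : Equiv.Perm X} {E : Set X} {x : X}
    (hx : ∃ k : ℕ, (T ^ ((k : ℤ) + 1)) x ∈ E) : (T ^ (returnTime T E x : ℤ)) x ∈ E := by
  have := Nat.sInf_mem (s := {k : ℕ | (T ^ ((k : ℤ) + 1)) x ∈ E}) hx
  simpa [returnTime] using this

theorem notMem_of_lt_returnTime {T : Equiv.Perm X} {E : Set X} {x : X} {j : ℕ} (hj0 : j ≠ 0)
    (hj : j < returnTime T E x) : (T ^ (j : ℤ)) x ∉ E := by
  obtain ⟨j, rfl⟩ := Nat.exists_eq_succ_of_ne_zero hj0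
  have := Nat.notMem_of_lt_sInf (s := {k : ℕ | (T ^ ((k : ℤ) + 1)) x ∈ E})
    (Nat.lt_of_succ_lt_succ hj)
  simpa using this

theorem lastVisit_zpow_of_lt_returnTime {T : Equiv.Perm X} {E : Set X} {x : X} (hx : x ∈ E)
    {j : ℕ} (hj : j < returnTime T E x) : lastVisit T E ((T ^ (j : ℤ)) x) = j := by
  have hmem : j ∈ {k : ℕ | (T ^ (-(k : ℤ))) ((T ^ (j : ℤ)) x) ∈ E} := by
    simpa [zpow_apply_zpow] using hx
  refine le_antisymm (Nat.sInf_le hmem) (not_lt.1 fun hlt => ?_)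
  have h : (T ^ (-(lastVisit T E ((T ^ (j : ℤ)) x) : ℤ))) ((T ^ (j : ℤ)) x) ∈ E :=
    lastVisit_mem ⟨j, hmem⟩
  rw [zpow_apply_zpow] at h
  have h2 : -((lastVisit T E ((T ^ (j : ℤ)) x) : ℕ) : ℤ) + j =
      ((j - lastVisit T E ((T ^ (j : ℤ)) x) : ℕ) : ℤ) := by omega
  rw [h2] at h
  exact notMem_of_lt_returnTime (by omega) (by omega) h

theorem lastVisit_lt_returnTime {T : Equiv.Perm X} {E : Set X} {x : X}
    (hx : ∃ k : ℕ, (T ^ ((k : ℤ) + 1)) ((T ^ (-(lastVisit T E x : ℤ))) x) ∈ E) :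
    lastVisit T E x < returnTime T E ((T ^ (-(lastVisit T E x : ℤ))) x) := by
  by_contra! hle
  have h := returnTime_mem hx
  rw [zpow_apply_zpow] at h
  set s := lastVisit T E x with hs
  set ρ := returnTime T E ((T ^ (-(s : ℤ))) x) with hρ
  have hρ0 : 0 < ρ := Nat.succ_pos _
  have h2 : (ρ : ℤ) + -(s : ℤ) = -((s - ρ : ℕ) : ℤ) := by omega
  rw [h2] at h
  have := Nat.sInf_le (s := {k : ℕ | (T ^ (-(k : ℤ))) x ∈ E}) h
  change s ≤ s - ρ at this
  omega

theorem orbitDigit_zpow {T : Equiv.Perm X} (m : ℕ → X → ℕ) {A : ℕ}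
    (e : (r : ℕ) → (Fin r → ℕ → ℕ) → Fin r → Fin (A + 1)) {E : Set X} {x : X} (hx : x ∈ E)
    {r : ℕ} (hr : returnTime T E x = r) (j : Fin r) :
    orbitDigit T m e E ((T ^ ((j : ℕ) : ℤ)) x) =
      e r (fun i k => m k ((T ^ ((i : ℕ) : ℤ)) x)) j := by
  subst hr
  have h := lastVisit_zpow_of_lt_returnTime hx j.2
  unfold orbitDigit
  rw [h, zpow_apply_zpow, neg_add_cancel, zpow_zero, Equiv.Perm.one_apply, blockDigit,
    dif_pos j.2]

/-- The messages can be decoded from the visits to `E` and the digits along the orbit. -/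
theorem messages_eq_of_orbitDigit_eq {T : Equiv.Perm X} {m : ℕ → X → ℕ} {A : ℕ}
    {e : (r : ℕ) → (Fin r → ℕ → ℕ) → Fin r → Fin (A + 1)} {E : Set X}
    {x y : X} (hpast : ∃ k : ℕ, (T ^ (-(k : ℤ))) x ∈ E)
    (hfuture : ∃ k : ℕ, (T ^ ((k : ℤ) + 1)) ((T ^ (-(lastVisit T E x : ℤ))) x) ∈ E)
    {V : (r : ℕ) → Set (Fin r → ℕ → ℕ)} (he : ∀ r, Set.InjOn (e r) (V r))
    (hVx : ∀ n : ℤ, (T ^ n) x ∈ E → ∀ r,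
      (fun (i : Fin r) (k : ℕ) => m k ((T ^ ((i : ℕ) : ℤ)) ((T ^ n) x))) ∈ V r)
    (hVy : ∀ n : ℤ, (T ^ n) y ∈ E → ∀ r,
      (fun (i : Fin r) (k : ℕ) => m k ((T ^ ((i : ℕ) : ℤ)) ((T ^ n) y))) ∈ V r)
    (hE : ∀ n : ℤ, (T ^ n) x ∈ E ↔ (T ^ n) y ∈ E)
    (hd : ∀ n : ℤ, orbitDigit T m e E ((T ^ n) x) = orbitDigit T m e E ((T ^ n) y)) (k : ℕ) :
    m k x = m k y := by
  set s := lastVisit T E x with hs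
  set x' := (T ^ (-(s : ℤ))) x with hx'
  set y' := (T ^ (-(s : ℤ))) y with hy'
  have hx'E : x' ∈ E := lastVisit_mem hpast
  have hy'E : y' ∈ E := (hE _).1 hx'E
  have hlt : s < returnTime T E x' := lastVisit_lt_returnTime hfuture
  have hr : returnTime T E y' = returnTime T E x' := by
    unfold returnTime
    simp only [hx', hy', zpow_apply_zpow, hE]
  have hcode : ∀ r, returnTime T E x' = r → returnTime T E y' = r →
      e r (fun i k => m k ((T ^ ((i : ℕ) : ℤ)) x')) =
        e r (fun i k => m k ((T ^ ((i : ℕ) : ℤ)) y')) := by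
    intro r h1 h2
    funext j
    rw [← orbitDigit_zpow m e hx'E h1 j, ← orbitDigit_zpow m e hy'E h2 j, hx', hy',
      zpow_apply_zpow, zpow_apply_zpow, hd]
  have hblock := he _ (hVx _ hx'E _) (hVy _ hy'E _) (hcode _ rfl hr)
  have := congrFun (congrFun hblock ⟨s, hlt⟩) k
  simpa [hx', hy', zpow_apply_zpow] using this

end Coding

section Label

variable {X : Type*} [MeasurableSpace X] {μ : Measure X}

theorem measurable_comp_nat {β : Type*} [MeasurableSpace β] {g : ℕ → X → β}
    (hg : ∀ n, Measurable (g n)) {s : X → ℕ} (hs : Measurable s) :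
    Measurable fun x => g (s x) x :=
  (measurable_from_prod_countable_left (f := fun p : X × ℕ => g p.2 p.1) hg).comp
    (measurable_id.prodMk hs)

variable {T : Equiv.Perm X}

theorem measurable_orbitDigit (hT : ∀ n : ℤ, Measurable ⇑(T ^ n)) {m : ℕ → X → ℕ}
    (hm : ∀ k, Measurable (m k)) {A : ℕ} {e : (r : ℕ) → (Fin r → ℕ → ℕ) → Fin r → Fin (A + 1)}
    (he : ∀ r, Measurable (e r)) {E : Set X} (hE : MeasurableSet E) :
    Measurable (orbitDigit T m e E) := by
  have hlast : Measurable (lastVisit T E) := measurable_sInf_nat fun k => hT _ hE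
  have hret : Measurable (returnTime T E) :=
    (measurable_sInf_nat fun k => hT _ hE).add_const 1
  have hback : Measurable fun x => (T ^ (-(lastVisit T E x : ℤ))) x :=
    measurable_comp_nat (g := fun n : ℕ => ⇑(T ^ (-(n : ℤ)))) (fun n => hT _) hlast
  have hdigit : ∀ r s, Measurable (blockDigit T m e r s) := fun r s => by
    unfold blockDigit
    split_ifs with h
    · refine (measurable_pi_apply _).comp ((he r).comp ?_)
      exact measurable_pi_lambda _ fun i => measurable_pi_lambda _ fun k => (hm k).comp (hT _)
    · exact measurable_const
  have hdigit' : ∀ s, Measurable fun x => blockDigit T m e (returnTime T E x) s x := fun s =>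
    measurable_comp_nat (g := fun r => blockDigit T m e r s) (fun r => hdigit r s) hret
  exact measurable_comp_nat
    (g := fun s x => blockDigit T m e (returnTime T E ((T ^ (-(lastVisit T E x : ℤ))) x)) s
      ((T ^ (-(lastVisit T E x : ℤ))) x)) (fun s => (hdigit' s).comp hback) hlast

omit [MeasurableSpace X] in
theorem messages_mem_affordableBlocks {m : ℕ → X → ℕ} {K : ℝ} {x : X}
    (hfin : ∀ n : ℤ, ∑' k, ENNReal.ofReal (messageCost k (m k ((T ^ n) x))) ≠ ⊤)
    (hx : ∀ n, birkhoffSum T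
      (fun x => (∑' k, ENNReal.ofReal (messageCost k (m k x))).toReal - K) n x ≤ 0) (r : ℕ) :
    (fun (i : Fin r) (k : ℕ) => m k ((T ^ ((i : ℕ) : ℤ)) x)) ∈ affordableBlocks r (K * r) := by
  intro N
  have h := hx r
  rw [birkhoffSum, Finset.sum_sub_distrib, Finset.sum_const, Finset.card_range, nsmul_eq_mul,
    sub_nonpos, mul_comm, Finset.sum_range] at h
  refine le_trans (Finset.sum_le_sum fun i _ => ?_) h
  have hi := hfin (i : ℕ)
  rw [zpow_natCast, ← Equiv.Perm.iterate_eq_pow] at hi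
  simp only [zpow_natCast, ← Equiv.Perm.iterate_eq_pow]
  rw [← ENNReal.ofReal_le_iff_le_toReal hi,
    ENNReal.ofReal_sum_of_nonneg fun _ _ => messageCost_nonneg _ _]
  rw [← Finset.sum_range fun k => ENNReal.ofReal (messageCost k (m k (T^[i] x)))]
  exact ENNReal.sum_le_tsum _

/-- Messages of finite total cost can be encoded in a finite-valued label. -/
theorem exists_label [IsProbabilityMeasure μ] (hT : Ergodic T μ) (hT' : Ergodic (⇑T⁻¹) μ)
    {m : ℕ → X → ℕ} (hm : ∀ k, Measurable (m k))
    (hsep : ∀ x y, (∀ k, ∀ n : ℤ, m k ((T ^ n) x) = m k ((T ^ n) y)) → x = y)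
    (hcost : ∫⁻ x, ∑' k, ENNReal.ofReal (messageCost k (m k x)) ∂μ ≠ ⊤) :
    ∃ (A : ℕ) (l : X → Bool × Fin (A + 1)) (P : X → Prop), Measurable l ∧ (∀ᵐ x ∂μ, P x) ∧
      ∀ x y, P x → P y → (∀ n : ℤ, l ((T ^ n) x) = l ((T ^ n) y)) → x = y := by
  classical
  have hTn := measurePreserving_zpow hT.toMeasurePreserving hT'.toMeasurePreserving
  set W : X → ENNReal := fun x => ∑' k, ENNReal.ofReal (messageCost k (m k x)) with hW
  have hWm : Measurable W := Measurable.tsum fun k =>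
    ENNReal.measurable_ofReal.comp ((measurable_of_countable (messageCost k)).comp (hm k))
  set K : ℝ := ∫ x, (W x).toReal ∂μ + 1 with hK
  have hInt : Integrable (fun x => (W x).toReal) μ :=
    integrable_toReal_of_lintegral_ne_top hWm.aemeasurable hcost
  set f : X → ℝ := fun x => (W x).toReal - K with hf
  have hfm : Measurable f := hWm.ennreal_toReal.sub_const K
  set E : Set X := {x | ∀ n, birkhoffSum T f n x ≤ 0} with hE
  have hEm : MeasurableSet E := by
    rw [hE, Set.ofPred_forall]
    refine .iInter fun n => measurableSet_le ?_ measurable_const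
    exact Finset.measurable_fun_sum _ fun i _ => hfm.comp (hT.measurable.iterate i)
  have hE0 : μ E ≠ 0 := measure_birkhoffSum_nonpos_ne_zero hT.toMeasurePreserving
    (hInt.sub (integrable_const K)) hfm (by
      rw [integral_sub hInt (integrable_const K)]
      simp [hK])
  obtain ⟨A, hA⟩ := exists_blockCode K
  choose e he hinj using hA
  refine ⟨A, fun x => (decide (x ∈ E), orbitDigit T m e E x), fun x => ∀ n : ℤ,
    W ((T ^ n) x) ≠ ⊤ ∧ (∃ k : ℕ, (T ^ ((k : ℤ) + 1)) ((T ^ n) x) ∈ E) ∧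
      ∃ k : ℕ, (T ^ (-(k : ℤ))) ((T ^ n) x) ∈ E, ?_, ?_, fun x y hx hy hxy => ?_⟩
  · exact (measurable_to_bool (by simpa [Set.preimage] using hEm)).prodMk
      (measurable_orbitDigit (fun n => (hTn n).measurable) hm he hEm)
  · refine ae_all_iff.2 fun n => (hTn n).quasiMeasurePreserving.ae
      (p := fun x => W x ≠ ⊤ ∧ (∃ k : ℕ, (T ^ ((k : ℤ) + 1)) x ∈ E) ∧
        ∃ k : ℕ, (T ^ (-(k : ℤ))) x ∈ E) ?_
    have hfuture := (hTn 1).quasiMeasurePreserving.ae (ae_exists_iterate_mem hT hEm hE0)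
    filter_upwards [ae_lt_top hWm hcost, hfuture, ae_exists_iterate_mem hT' hEm hE0]
      with x h1 ⟨k, h2⟩ ⟨j, h3⟩
    refine ⟨h1.ne, ⟨k, ?_⟩, ⟨j, ?_⟩⟩
    · rwa [zpow_add, Equiv.Perm.mul_apply, zpow_natCast, ← Equiv.Perm.iterate_eq_pow]
    · rwa [zpow_neg, ← inv_zpow, zpow_natCast, ← Equiv.Perm.iterate_eq_pow]
  · have haff : ∀ z, (∀ n : ℤ, W ((T ^ n) z) ≠ ⊤) → ∀ n : ℤ, (T ^ n) z ∈ E → ∀ r,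
        (fun (i : Fin r) (k : ℕ) => m k ((T ^ ((i : ℕ) : ℤ)) ((T ^ n) z))) ∈
          affordableBlocks r (K * r) := fun z hz n hn r =>
      messages_mem_affordableBlocks (fun n' => by rw [zpow_apply_zpow]; exact hz _) hn r
    have hshift : ∀ z, (∀ n : ℤ, W ((T ^ n) z) ≠ ⊤) → ∀ n' n : ℤ, W ((T ^ n) ((T ^ n') z)) ≠ ⊤ :=
      fun z hz n' n => by rw [zpow_apply_zpow]; exact hz _
    refine hsep x y fun k n => ?_
    refine messages_eq_of_orbitDigit_eq (hx n).2.2 ?_ hinj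
      (haff _ (hshift x (fun n => (hx n).1) n)) (haff _ (hshift y (fun n => (hy n).1) n)) ?_ ?_ k
    · rw [zpow_apply_zpow]
      exact (hx _).2.1
    · intro n'
      simp only [zpow_apply_zpow]
      simpa using congrArg Prod.fst (hxy (n' + n))
    · intro n'
      simp only [zpow_apply_zpow]
      exact congrArg Prod.snd (hxy (n' + n))

end Label

section Generator

variable {X : Type*} [MeasurableSpace X] {μ : Measure X}

/-- A finite-valued label whose bi-infinite orbit names determine almost every point yields a
generating partition. -/
theorem exists_generating_partition [StandardBorelSpace X] {T : Equiv.Perm X}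
    (hT : ∀ n : ℤ, Measurable ⇑(T ^ n)) {ι : Type*} [Fintype ι] [MeasurableSpace ι]
    [MeasurableSingletonClass ι] {l : X → ι} (hl : Measurable l) {P : X → Prop}
    (hP : ∀ᵐ x ∂μ, P x)
    (hsep : ∀ x y, P x → P y → (∀ n : ℤ, l ((T ^ n) x) = l ((T ^ n) y)) → x = y) :
    ∃ (N : ℕ) (Z : Fin N → Set X), (∀ i, MeasurableSet (Z i)) ∧
      Pairwise (Function.onFun Disjoint Z) ∧ (⋃ i, Z i = Set.univ) ∧
      ∀ B : Set X, MeasurableSet B → ∃ A : Set X,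
        MeasurableSet[MeasurableSpace.generateFrom
          {A : Set X | ∃ (n : ℕ) (i : Fin N),
            A = T^[n] ⁻¹' Z i ∨ A = (⇑T⁻¹)^[n] ⁻¹' Z i}] A ∧
        μ (symmDiff A B) = 0 := by
  classical
  let e := Fintype.equivFin ι
  refine ⟨Fintype.card ι, fun i => (e ∘ l) ⁻¹' {i}, fun i => ?_, fun i j hij => ?_, ?_,
    fun B hB => ?_⟩
  · exact ((measurable_of_finite e).comp hl) (measurableSet_singleton i)
  · exact Disjoint.preimage _ (Set.disjoint_singleton.2 hij)
  · exact Set.eq_univ_of_forall fun x => Set.mem_iUnion.2 ⟨_, rfl⟩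
  set 𝓖 : Set (Set X) := {A : Set X | ∃ (n : ℕ) (i : Fin (Fintype.card ι)),
    A = T^[n] ⁻¹' ((e ∘ l) ⁻¹' {i}) ∨ A = (⇑T⁻¹)^[n] ⁻¹' ((e ∘ l) ⁻¹' {i})} with h𝓖
  let name : X → ℤ → ι := fun x n => l ((T ^ n) x)
  have hname : Measurable name := measurable_pi_lambda _ fun n => hl.comp (hT n)
  set X₀ : Set X := (toMeasurable μ {x | ¬ P x})ᶜ with hX₀
  have hX₀m : MeasurableSet X₀ := (measurableSet_toMeasurable _ _).compl
  have hX₀P : ∀ x ∈ X₀, P x := fun x hx => by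
    by_contra h
    exact hx (subset_toMeasurable μ {x | ¬ P x} h)
  have hX₀c : μ X₀ᶜ = 0 := by
    rw [hX₀, compl_compl, measure_toMeasurable]
    exact hP
  have hinj : Set.InjOn name X₀ := fun x hx y hy hxy =>
    hsep x y (hX₀P x hx) (hX₀P y hy) fun n => congrFun hxy n
  have hsub : B ∩ X₀ ⊆ X₀ := Set.inter_subset_right
  have himage : MeasurableSet (name '' (B ∩ X₀)) :=
    (hB.inter hX₀m).image_of_measurable_injOn hname (hinj.mono hsub)
  refine ⟨name ⁻¹' (name '' (B ∩ X₀)), ?_, ?_⟩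
  · have hgen : Measurable[MeasurableSpace.generateFrom 𝓖] name := by
      refine @measurable_pi_lambda _ _ _ (MeasurableSpace.generateFrom 𝓖) _ _ fun n => ?_
      refine @measurable_to_countable' _ _ _ _ (MeasurableSpace.generateFrom 𝓖) _ fun i => ?_
      refine MeasurableSpace.measurableSet_generateFrom ?_
      have h : ∀ f : X → X, (fun x => l (f x)) ⁻¹' {i} = f ⁻¹' ((e ∘ l) ⁻¹' {e i}) := fun f => by
        ext
        simp
      cases n with
      | ofNat n =>
        refine ⟨n, e i, Or.inl ?_⟩
        rw [Equiv.Perm.iterate_eq_pow]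
        exact h _
      | negSucc n =>
        refine ⟨n + 1, e i, Or.inr ?_⟩
        rw [Equiv.Perm.iterate_eq_pow, inv_pow]
        exact h _
    exact hgen himage
  · refine measure_mono_null (fun x hx => ?_) hX₀c
    refine fun hx₀ => ?_
    rcases hx with ⟨⟨y, ⟨hyB, hy⟩, hxy⟩, hxB⟩ | ⟨hxB, hx'⟩
    · exact hxB (hinj hy hx₀ hxy ▸ hyB)
    · exact hx' ⟨x, ⟨hxB, hx₀⟩, rfl⟩

end Generator

section Atoms

variable {X : Type*} [MeasurableSpace X] {μ : Measure X} [IsProbabilityMeasure μ]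

/-- In the presence of an atom, the system lives on a single orbit. -/
theorem exists_label_of_atom [MeasurableSingletonClass X] {T : Equiv.Perm X}
    (hT : Ergodic T μ) {x₀ : X} (hx₀ : μ {x₀} ≠ 0) :
    ∃ (l : X → Bool) (P : X → Prop), Measurable l ∧ (∀ᵐ x ∂μ, P x) ∧
      ∀ x y, P x → P y → (∀ n : ℤ, l ((T ^ n) x) = l ((T ^ n) y)) → x = y := by
  classical
  refine ⟨fun x => decide (x = x₀), fun x => ∃ n : ℕ, T^[n] x = x₀, ?_,
    ae_exists_iterate_mem hT (measurableSet_singleton x₀) hx₀, ?_⟩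
  · exact measurable_to_bool (by simp [Set.preimage])
  · rintro x y ⟨n, hn⟩ - hxy
    rw [Equiv.Perm.iterate_eq_pow] at hn
    have h := hxy n
    simp only [zpow_natCast, hn, decide_true] at h
    exact (T ^ n).injective (hn.trans (of_decide_eq_true h.symm).symm)

/-- A separating sequence of tests shows that an atomless measure takes small positive values. -/
theorem exists_small_measure {b : ℕ → X → Bool} (hb : ∀ k, Measurable (b k))
    (hsep : ∀ x y, (∀ k, b k x = b k y) → x = y) (hatom : ∀ x, μ {x} = 0) {ε : ℝ} (hε : 0 < ε) :
    ∃ A, MeasurableSet A ∧ 0 < μ.real A ∧ μ.real A < ε := by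
  let F : (k : ℕ) → X → Fin k → Bool := fun k x i => b i x
  have hF : ∀ k, Measurable (F k) := fun k => measurable_pi_lambda _ fun i => hb i
  have hpos : ∀ᵐ x ∂μ, ∀ k, 0 < μ.real (F k ⁻¹' {F k x}) :=
    ae_all_iff.2 fun k => ae_measureReal_fiber_pos (F k)
  obtain ⟨x, hx⟩ := hpos.exists
  have hanti : Antitone fun k => F k ⁻¹' {F k x} := fun j k hjk y hy => by
    funext i
    exact congrFun (show F k y = F k x from hy) (Fin.castLE hjk i)
  have hinter : ⋂ k, F k ⁻¹' {F k x} = {x} := by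
    refine Set.Subset.antisymm (fun y hy => hsep y x fun k => ?_) (by simp)
    exact congrFun (Set.mem_iInter.1 hy (k + 1)) (Fin.last k)
  have hlim := tendsto_measure_iInter_atTop (μ := μ)
    (fun k => ((hF k) (measurableSet_singleton (F k x))).nullMeasurableSet) hanti
    ⟨0, measure_ne_top _ _⟩
  rw [hinter, hatom] at hlim
  have hlim' := (ENNReal.tendsto_toReal ENNReal.zero_ne_top).comp hlim
  obtain ⟨k, hk⟩ := (hlim'.eventually_lt_const (by simpa using hε)).exists
  exact ⟨_, hF k (measurableSet_singleton _), hx k, hk⟩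

end Atoms

end KriegerGenerator

open KriegerGenerator

/-- **Krieger generator theorem.** Let `(X, 𝓑, μ)` be a standard Borel
probability space, `T : X → X` a bimeasurable bijection (with measurable inverse `S`)
preserving `μ` and ergodic, with finite Kolmogorov–Sinai entropy (the relative entropies
`h_μ(T, Z)` over all finite measurable partitions `Z` are bounded above). Then there is a
finite measurable partition `Z` of `X` which is generating for `T`: the smallest σ-algebra
containing `T^{-n}I` for all `n ∈ ℤ` and all elements `I` of `Z` coincides with `𝓑` up to
`μ`-null sets. -/
theorem statement15 {X : Type*} [MeasurableSpace X] [StandardBorelSpace X]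
    (μ : Measure X) [IsProbabilityMeasure μ]
    (T S : X → X) (hT : Measurable T) (hS : Measurable S)
    (hTS : Function.LeftInverse S T) (hST : Function.RightInverse S T)
    (hTμ : MeasurePreserving T μ μ) (herg : Ergodic T μ)
    (hfin : ∃ C : ℝ, ∀ (N : ℕ) (Z : Fin N → Set X), (∀ i, MeasurableSet (Z i)) →
      Pairwise (Function.onFun Disjoint Z) → (⋃ i, Z i = Set.univ) →
      ∀ h : ℝ, Tendsto (fun n : ℕ => joinEntropy μ T Z n / n) atTop (nhds h) → h ≤ C) :
    ∃ (N : ℕ) (Z : Fin N → Set X), (∀ i, MeasurableSet (Z i)) ∧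
      Pairwise (Function.onFun Disjoint Z) ∧ (⋃ i, Z i = Set.univ) ∧
      ∀ B : Set X, MeasurableSet B → ∃ A : Set X,
        MeasurableSet[MeasurableSpace.generateFrom
          {A : Set X | ∃ (n : ℕ) (i : Fin N),
            A = T^[n] ⁻¹' Z i ∨ A = S^[n] ⁻¹' Z i}] A ∧
        μ (symmDiff A B) = 0 := by
  obtain ⟨C, hC⟩ := hfin
  let τ : Equiv.Perm X := ⟨T, S, hTS, hST⟩
  have hτ : Ergodic τ μ := herg
  have hτ' : Ergodic (⇑τ⁻¹) μ := by
    let φ : X ≃ᵐ X := ⟨τ, hT, hS⟩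
    have h : Ergodic φ μ := herg
    exact h.symm
  have hpow : ∀ n : ℤ, Measurable ⇑(τ ^ n) := fun n =>
    (measurePreserving_zpow hτ.toMeasurePreserving hτ'.toMeasurePreserving n).measurable
  by_cases hatom : ∃ x, μ {x} ≠ 0
  · obtain ⟨x₀, hx₀⟩ := hatom
    obtain ⟨l, P, hl, hP, hsep⟩ := exists_label_of_atom hτ hx₀
    exact exists_generating_partition hpow hl hP hsep
  push Not at hatom
  obtain ⟨g, hg, hg'⟩ := MeasurableSpace.measurable_injection_nat_bool_of_countablySeparated X
  have hb : ∀ k, Measurable fun x => g x k := fun k => (measurable_pi_apply k).comp hg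
  have hbsep : ∀ x y, (∀ k, g x k = g y k) → x = y := fun x y h => hg' (funext h)
  obtain ⟨m, hm, hmsep, hcost⟩ := exists_messages_of_separating hτ hτ'
    (fun ε hε => exists_small_measure hb hbsep hatom hε) (b := fun k x => g x k) hb hbsep (C := C)
    fun k q hq h hh => by
      let e := Fintype.equivFin (Fin k → Bool)
      refine hC _ (fun i => (e ∘ q) ⁻¹' {i}) (fun i => ?_) (fun i j hij => ?_) ?_ h ?_
      · exact ((measurable_of_finite e).comp hq) (measurableSet_singleton i)
      · exact Disjoint.preimage _ (Set.disjoint_singleton.2 hij)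
      · exact Set.eq_univ_of_forall fun x => Set.mem_iUnion.2 ⟨_, rfl⟩
      · simp only [joinEntropy_eq_rvEntropy]
        exact hh
  obtain ⟨A, l, P, hl, hP, hsep⟩ := exists_label hτ hτ' hm hmsep hcost
  exact exists_generating_partition hpow hl hP hsep
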